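/- Assume 0 < a₁ < a₂ < a₃ < a₄ < a₅ < a₆ < 1, and that m is strictly increasing on [0,a₁], on [a₃,a₄], and on [a₅,a₆]; m is strictly decreasing on [a₁,a₂]; and m is constant on [a₂,a₃], on [a₄,a₅], and on [a₆,1]. Then lim_{s→∞} λ₁ᴺ(s) = min{ c(a₁), λ₁^{DD}(a₂,a₃), λ₁^{ND}(a₄,a₅), λ₁^{NN}(a₆,1) }. -/

import Mathlib

open MeasureTheory Filter Set

/-- The Neumann principal eigenvalue of `-φ'' - 2 s m' φ' + c φ = λ φ` on `(0,1)`,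
via its variational characterization. -/
noncomputable def lambdaN (m c : ℝ → ℝ) (s : ℝ) : ℝ :=
  sInf {l : ℝ | ∃ φ : ℝ → ℝ, ContDiff ℝ 1 φ ∧
    (∫ x in (0:ℝ)..1, Real.exp (2 * s * m x) * (φ x) ^ 2) = 1 ∧
    l = ∫ x in (0:ℝ)..1, Real.exp (2 * s * m x) * ((deriv φ x) ^ 2 + c x * (φ x) ^ 2)}

/-- The principal eigenvalue of `-φ'' + c φ = λ φ` on `(a,b)`, with a Dirichlet
condition at `a` iff `dirA = true` and at `b` iff `dirB = true`
(Neumann, i.e. no constraint, otherwise), via its variational characterization. -/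
noncomputable def lambdaIJ (c : ℝ → ℝ) (dirA dirB : Bool) (a b : ℝ) : ℝ :=
  sInf {l : ℝ | ∃ φ : ℝ → ℝ, ContDiff ℝ 1 φ ∧
    (dirA = true → φ a = 0) ∧ (dirB = true → φ b = 0) ∧
    (∫ x in a..b, (φ x) ^ 2) = 1 ∧
    l = ∫ x in a..b, ((deriv φ x) ^ 2 + c x * (φ x) ^ 2)}

/-- Weighted `H¹` energy of `φ` on `[l, r]` with weight `exp (2 s m)`. -/
noncomputable def weightedEnergy (m φ : ℝ → ℝ) (s l r : ℝ) : ℝ :=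
  ∫ x in l..r, Real.exp (2 * s * m x) * ((deriv φ x) ^ 2 + (φ x) ^ 2)

/-- For large `s`, the weighted value of `φ²` at `x` is negligible with respect to
the weighted energy on `[l, r]`. -/
def NegligibleAt (m : ℝ → ℝ) (l r x : ℝ) : Prop :=
  ∀ η > 0, ∀ᶠ s in atTop, ∀ φ : ℝ → ℝ, ContDiff ℝ 1 φ →
    Real.exp (2 * s * m x) * (φ x) ^ 2 ≤ η * weightedEnergy m φ s l r

/-- For large `s`, the weighted mass of `φ²` on `[u, v]` is negligible with respect to
the weighted energy on `[l, r]`. -/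
def NegligibleMass (m : ℝ → ℝ) (l r u v : ℝ) : Prop :=
  ∀ η > 0, ∀ᶠ s in atTop, ∀ φ : ℝ → ℝ, ContDiff ℝ 1 φ →
    (∫ x in u..v, Real.exp (2 * s * m x) * (φ x) ^ 2) ≤ η * weightedEnergy m φ s l r

/-- For large `s`, the Rayleigh quotient on `[u, v]` is at least `Λ`, up to an error that is
negligible with respect to the weighted energy on `[l, r]`. -/
def AsymptoticLowerBound (m c : ℝ → ℝ) (Λ l r u v : ℝ) : Prop :=
  ∀ η > 0, ∀ᶠ s in atTop, ∀ φ : ℝ → ℝ, ContDiff ℝ 1 φ →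
    -(η * weightedEnergy m φ s l r) ≤
      ∫ x in u..v, Real.exp (2 * s * m x) * ((deriv φ x) ^ 2 + (c x - Λ) * (φ x) ^ 2)

lemma weightedEnergy_mono {m φ : ℝ → ℝ} (hm : Continuous m) (hφ : ContDiff ℝ 1 φ)
    {s l r l' r' : ℝ} (hl : l' ≤ l) (hlr : l ≤ r) (hr : r ≤ r') :
    weightedEnergy m φ s l r ≤ weightedEnergy m φ s l' r' := by
  have h0 := hφ.continuous
  have h1 := hφ.continuous_deriv le_rfl
  unfold weightedEnergy
  refine intervalIntegral.integral_mono_interval hl hlr hr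
    (Eventually.of_forall fun x => ?_) ?_
  · simp only [Pi.zero_apply]; positivity
  · exact Continuous.intervalIntegrable (by fun_prop) _ _

lemma weightedEnergy_nonneg (m φ : ℝ → ℝ) {s l r : ℝ} (hlr : l ≤ r) :
    0 ≤ weightedEnergy m φ s l r :=
  intervalIntegral.integral_nonneg hlr fun x _ => by positivity

lemma weightedMass_le_energy {m φ : ℝ → ℝ} (hm : Continuous m) (hφ : ContDiff ℝ 1 φ)
    {s l r : ℝ} (hlr : l ≤ r) :
    (∫ x in l..r, Real.exp (2 * s * m x) * (φ x) ^ 2) ≤ weightedEnergy m φ s l r := by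
  have h0 := hφ.continuous
  have h1 := hφ.continuous_deriv le_rfl
  refine intervalIntegral.integral_mono_on hlr
    (Continuous.intervalIntegrable (by fun_prop) _ _)
    (Continuous.intervalIntegrable (by fun_prop) _ _) fun x _ => ?_
  gcongr
  nlinarith [sq_nonneg (deriv φ x)]

lemma weightedEnergy_comp_neg (m φ : ℝ → ℝ) (s l r : ℝ) :
    weightedEnergy (fun x => m (-x)) (fun x => φ (-x)) s l r =
      weightedEnergy m φ s (-r) (-l) := by
  unfold weightedEnergy
  rw [← intervalIntegral.integral_comp_neg]
  simp [deriv_comp_neg]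

lemma NegligibleAt.mono {m : ℝ → ℝ} (hm : Continuous m) {l r l' r' x : ℝ}
    (h : NegligibleAt m l r x) (hl : l' ≤ l) (hlr : l ≤ r) (hr : r ≤ r') :
    NegligibleAt m l' r' x := fun η hη => by
  filter_upwards [h η hη] with s hs φ hφ
  exact (hs φ hφ).trans (by have := weightedEnergy_mono (s := s) hm hφ hl hlr hr; gcongr)

lemma AsymptoticLowerBound.mono {m c : ℝ → ℝ} (hm : Continuous m) {Λ l r l' r' u v : ℝ}
    (h : AsymptoticLowerBound m c Λ l r u v) (hl : l' ≤ l) (hlr : l ≤ r) (hr : r ≤ r') :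
    AsymptoticLowerBound m c Λ l' r' u v := fun η hη => by
  filter_upwards [h η hη] with s hs φ hφ
  refine le_trans ?_ (hs φ hφ)
  have := weightedEnergy_mono (s := s) hm hφ hl hlr hr
  gcongr

lemma NegligibleAt.of_comp_neg {m : ℝ → ℝ} {l r x : ℝ}
    (h : NegligibleAt (fun y => m (-y)) (-r) (-l) (-x)) : NegligibleAt m l r x := fun η hη => by
  filter_upwards [h η hη] with s hs φ hφ
  have := hs (fun y => φ (-y)) (hφ.comp contDiff_neg)
  simpa [weightedEnergy_comp_neg] using this

lemma AsymptoticLowerBound.of_comp_neg {m c : ℝ → ℝ} {Λ l r u v : ℝ}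
    (h : AsymptoticLowerBound (fun y => m (-y)) (fun y => c (-y)) Λ (-r) (-l) (-v) (-u)) :
    AsymptoticLowerBound m c Λ l r u v := fun η hη => by
  filter_upwards [h η hη] with s hs φ hφ
  have := hs (fun y => φ (-y)) (hφ.comp contDiff_neg)
  rw [weightedEnergy_comp_neg, neg_neg, neg_neg] at this
  refine this.trans_eq ?_
  rw [← neg_neg u, ← neg_neg v, ← intervalIntegral.integral_comp_neg]
  simp [deriv_comp_neg]

lemma AsymptoticLowerBound.trans {m c : ℝ → ℝ} (hm : Continuous m) (hc : Continuous c)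
    {Λ l r u v w : ℝ} (h₁ : AsymptoticLowerBound m c Λ l r u v)
    (h₂ : AsymptoticLowerBound m c Λ l r v w) : AsymptoticLowerBound m c Λ l r u w :=
    fun η hη => by
  filter_upwards [h₁ (η / 2) (half_pos hη), h₂ (η / 2) (half_pos hη)] with s hs₁ hs₂ φ hφ
  have h0 := hφ.continuous
  have h1 := hφ.continuous_deriv le_rfl
  rw [← intervalIntegral.integral_add_adjacent_intervals (b := v)
    (Continuous.intervalIntegrable (by fun_prop) _ _)
    (Continuous.intervalIntegrable (by fun_prop) _ _)]
  linarith [hs₁ φ hφ, hs₂ φ hφ]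

lemma sq_sub_le_mul_integral_deriv_sq {φ : ℝ → ℝ} (hφ : ContDiff ℝ 1 φ) {x y : ℝ} (hxy : x ≤ y) :
    (φ y - φ x) ^ 2 ≤ (y - x) * ∫ t in x..y, (deriv φ t) ^ 2 := by
  have h1 := hφ.continuous_deriv le_rfl
  rcases hxy.eq_or_lt with rfl | hlt
  · simp
  have hFTC : ∫ t in x..y, deriv φ t = φ y - φ x :=
    intervalIntegral.integral_deriv_eq_sub (fun t _ => (hφ.differentiable one_ne_zero) t)
      (h1.intervalIntegrable _ _)
  have key : 0 ≤ ∫ t in x..y, ((y - x) * deriv φ t - (φ y - φ x)) ^ 2 :=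
    intervalIntegral.integral_nonneg hxy fun t _ => sq_nonneg _
  have expand : ∫ t in x..y, ((y - x) * deriv φ t - (φ y - φ x)) ^ 2
      = (y - x) ^ 2 * (∫ t in x..y, (deriv φ t) ^ 2)
        - 2 * (y - x) * (φ y - φ x) * (φ y - φ x) + (φ y - φ x) ^ 2 * (y - x) := by
    have : ∀ t, ((y - x) * deriv φ t - (φ y - φ x)) ^ 2 = (y - x) ^ 2 * (deriv φ t) ^ 2
        - 2 * (y - x) * (φ y - φ x) * deriv φ t + (φ y - φ x) ^ 2 := fun t => by ring
    simp_rw [this]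
    rw [intervalIntegral.integral_add (Continuous.intervalIntegrable (by fun_prop) _ _)
      (Continuous.intervalIntegrable (by fun_prop) _ _),
      intervalIntegral.integral_sub (Continuous.intervalIntegrable (by fun_prop) _ _)
      (Continuous.intervalIntegrable (by fun_prop) _ _),
      intervalIntegral.integral_const_mul, intervalIntegral.integral_const_mul, hFTC]
    simp; ring
  rw [expand] at key
  have hpos : 0 < y - x := sub_pos.2 hlt
  have : 0 ≤ (y - x) * ((y - x) * (∫ t in x..y, (deriv φ t) ^ 2) - (φ y - φ x) ^ 2) := by
    nlinarith
  have := nonneg_of_mul_nonneg_right this hpos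
  linarith

/-- Pointwise bound along a monotone stretch of `m`. -/
lemma weighted_sq_mul_le {m φ : ℝ → ℝ} (hm : Continuous m) (hφ : ContDiff ℝ 1 φ)
    {s γ x y₁ y₂ : ℝ} (hs : 0 ≤ s) (hx : x ≤ y₁) (hy : y₁ ≤ y₂)
    (hmono : MonotoneOn m (Icc x y₂)) (hγ : ∀ y ∈ Icc y₁ y₂, m x + γ ≤ m y) :
    (y₂ - y₁) * (Real.exp (2 * s * m x) * (φ x) ^ 2) ≤
      2 * Real.exp (-(2 * s * γ)) * weightedEnergy m φ s y₁ y₂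
        + 2 * (y₂ - x) * (y₂ - y₁) * weightedEnergy m φ s x y₂ := by
  have h0 := hφ.continuous
  have h1 := hφ.continuous_deriv le_rfl
  set T := weightedEnergy m φ s x y₂ with hT
  have hpt : ∀ y ∈ Icc y₁ y₂, Real.exp (2 * s * m x) * (φ x) ^ 2 ≤
      2 * Real.exp (-(2 * s * γ)) * (Real.exp (2 * s * m y) * (φ y) ^ 2)
        + 2 * (y₂ - x) * T := by
    intro y hy'
    have hxy : x ≤ y := hx.trans hy'.1
    have hcs := sq_sub_le_mul_integral_deriv_sq hφ hxy
    have hw : Real.exp (2 * s * m x) ≤ Real.exp (-(2 * s * γ)) * Real.exp (2 * s * m y) := by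
      rw [← Real.exp_add]
      apply Real.exp_le_exp.2
      nlinarith [hγ y hy']
    have hI : Real.exp (2 * s * m x) * ∫ t in x..y, (deriv φ t) ^ 2 ≤ T := by
      rw [← intervalIntegral.integral_const_mul]
      refine le_trans ?_ (weightedEnergy_mono hm hφ le_rfl hxy hy'.2)
      refine intervalIntegral.integral_mono_on hxy
        (Continuous.intervalIntegrable (by fun_prop) _ _)
        (Continuous.intervalIntegrable (by fun_prop) _ _) fun t ht => ?_
      have : m x ≤ m t := hmono ⟨le_rfl, hx.trans hy⟩ ⟨ht.1, ht.2.trans hy'.2⟩ ht.1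
      gcongr
      nlinarith [sq_nonneg (φ t)]
    have hT0 : 0 ≤ T := weightedEnergy_nonneg _ _ (hx.trans hy)
    calc Real.exp (2 * s * m x) * (φ x) ^ 2
        ≤ Real.exp (2 * s * m x) * (2 * (φ y) ^ 2 + 2 * (φ y - φ x) ^ 2) := by
          gcongr
          nlinarith [sq_nonneg (φ y + (φ y - φ x))]
      _ ≤ Real.exp (2 * s * m x) *
          (2 * (φ y) ^ 2 + 2 * ((y - x) * ∫ t in x..y, (deriv φ t) ^ 2)) := by gcongr
      _ = 2 * Real.exp (2 * s * m x) * (φ y) ^ 2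
          + 2 * (y - x) * (Real.exp (2 * s * m x) * ∫ t in x..y, (deriv φ t) ^ 2) := by ring
      _ ≤ 2 * (Real.exp (-(2 * s * γ)) * Real.exp (2 * s * m y)) * (φ y) ^ 2
          + 2 * (y - x) * T := by
          have : 0 ≤ y - x := sub_nonneg.2 hxy
          gcongr
      _ ≤ 2 * (Real.exp (-(2 * s * γ)) * Real.exp (2 * s * m y)) * (φ y) ^ 2
          + 2 * (y₂ - x) * T := by
          have := hy'.2
          gcongr
      _ = _ := by ring
  have hmean := intervalIntegral.integral_mono_on (μ := volume) hy
    (f := fun _ => Real.exp (2 * s * m x) * (φ x) ^ 2)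
    (Continuous.intervalIntegrable (by fun_prop) _ _)
    (Continuous.intervalIntegrable (by fun_prop) _ _) hpt
  rw [intervalIntegral.integral_add (Continuous.intervalIntegrable (by fun_prop) _ _)
    (Continuous.intervalIntegrable (by fun_prop) _ _), intervalIntegral.integral_const,
    intervalIntegral.integral_const_mul (2 * Real.exp (-(2 * s * γ))),
    intervalIntegral.integral_const, smul_eq_mul, smul_eq_mul] at hmean
  have := weightedMass_le_energy (s := s) hm hφ hy
  have h2 : 2 * Real.exp (-(2 * s * γ)) * (∫ x in y₁..y₂, Real.exp (2 * s * m x) * (φ x) ^ 2) ≤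
      2 * Real.exp (-(2 * s * γ)) * weightedEnergy m φ s y₁ y₂ := by gcongr
  linarith

lemma eventually_weighted_sq_le_of_strictMonoOn {m : ℝ → ℝ} (hm : Continuous m) {p q q' : ℝ}
    (hpq' : p ≤ q') (hq : q' < q) (hmono : StrictMonoOn m (Icc p q)) {η : ℝ} (hη : 0 < η) :
    ∀ᶠ s in atTop, ∀ φ : ℝ → ℝ, ContDiff ℝ 1 φ → ∀ x ∈ Icc p q',
      Real.exp (2 * s * m x) * (φ x) ^ 2 ≤ η * weightedEnergy m φ s p q := by
  obtain ⟨δ, hδ0, hδη, hδq⟩ : ∃ δ > 0, 8 * δ ≤ η ∧ q' + 2 * δ ≤ q :=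
    ⟨min (η / 8) ((q - q') / 2), lt_min (by linarith) (by linarith),
      by linarith [min_le_left (η / 8) ((q - q') / 2)],
      by linarith [min_le_right (η / 8) ((q - q') / 2)]⟩
  obtain ⟨x₀, hx₀, hmin⟩ := isCompact_Icc.exists_isMinOn (nonempty_Icc.2 hpq')
    (f := fun x => m (x + δ) - m x) (by fun_prop)
  set γ := m (x₀ + δ) - m x₀ with hγ
  have hγ0 : 0 < γ := sub_pos.2 <|
    hmono ⟨hx₀.1, by linarith [hx₀.2]⟩ ⟨by linarith [hx₀.1], by linarith [hx₀.2]⟩ (by linarith)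
  have hlim : Tendsto (fun s : ℝ => Real.exp (-(2 * s * γ))) atTop (nhds 0) := by
    apply Real.tendsto_exp_neg_atTop_nhds_zero.comp
    exact (tendsto_id.const_mul_atTop two_pos).atTop_mul_const hγ0
  filter_upwards [eventually_ge_atTop 0, hlim.eventually_lt_const (show 0 < η * δ / 4 by positivity)]
    with s hs hexp φ hφ x hx
  have hmx : ∀ y ∈ Icc (x + δ) (x + 2 * δ), m x + γ ≤ m y := fun y hy => by
    have h1 : γ ≤ m (x + δ) - m x := hmin hx
    have h2 : m (x + δ) ≤ m y := hmono.monotoneOn ⟨by linarith [hx.1], by linarith [hx.2]⟩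
      ⟨by linarith [hx.1, hy.1], by linarith [hx.2, hy.2]⟩ hy.1
    linarith
  have key := weighted_sq_mul_le hm hφ hs (y₁ := x + δ) (y₂ := x + 2 * δ) (by linarith)
    (by linarith) (hmono.monotoneOn.mono (Icc_subset_Icc hx.1 (by linarith [hx.2]))) hmx
  have hT1 : weightedEnergy m φ s (x + δ) (x + 2 * δ) ≤ weightedEnergy m φ s p q :=
    weightedEnergy_mono hm hφ (by linarith [hx.1]) (by linarith) (by linarith [hx.2])
  have hT2 : weightedEnergy m φ s x (x + 2 * δ) ≤ weightedEnergy m φ s p q :=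
    weightedEnergy_mono hm hφ hx.1 (by linarith) (by linarith [hx.2])
  have hT0 : 0 ≤ weightedEnergy m φ s p q := weightedEnergy_nonneg _ _ (by linarith)
  set T := weightedEnergy m φ s p q
  have hT3 := weightedEnergy_nonneg m φ (s := s) (show x + δ ≤ x + 2 * δ by linarith)
  have hA : 2 * Real.exp (-(2 * s * γ)) * weightedEnergy m φ s (x + δ) (x + 2 * δ) ≤
      2 * (η * δ / 4) * T := by gcongr
  have hB : 2 * (x + 2 * δ - x) * (x + 2 * δ - (x + δ)) * weightedEnergy m φ s x (x + 2 * δ) ≤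
      2 * (x + 2 * δ - x) * (x + 2 * δ - (x + δ)) * T := by
    have : 0 ≤ 2 * (x + 2 * δ - x) * (x + 2 * δ - (x + δ)) := by
      ring_nf; positivity
    gcongr
  have hC : δ * (Real.exp (2 * s * m x) * (φ x) ^ 2) ≤ δ * (η * T) := by
    have e1 : x + 2 * δ - (x + δ) = δ := by ring
    have e2 : x + 2 * δ - x = 2 * δ := by ring
    rw [e1, e2] at hB key
    have : 8 * δ * (δ * T) ≤ η * (δ * T) := by gcongr
    nlinarith
  exact le_of_mul_le_mul_left hC hδ0

lemma negligibleAt_of_strictMonoOn {m : ℝ → ℝ} (hm : Continuous m) {p q : ℝ} (hpq : p < q)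
    (hmono : StrictMonoOn m (Icc p q)) : NegligibleAt m p q p := fun η hη => by
  filter_upwards [eventually_weighted_sq_le_of_strictMonoOn hm le_rfl hpq hmono hη] with s hs φ hφ
  exact hs φ hφ p ⟨le_rfl, le_rfl⟩

lemma negligibleMass_of_strictMonoOn {m : ℝ → ℝ} (hm : Continuous m) {p q q' : ℝ}
    (hpq' : p ≤ q') (hq : q' < q) (hmono : StrictMonoOn m (Icc p q)) :
    NegligibleMass m p q p q' := fun η hη => by
  have hL : 0 < q' - p + 1 := by linarith
  filter_upwards [eventually_weighted_sq_le_of_strictMonoOn hm hpq' hq hmono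
    (div_pos hη hL)] with s hs φ hφ
  have h0 := hφ.continuous
  have := intervalIntegral.integral_mono_on (μ := volume) hpq'
    (g := fun _ => η / (q' - p + 1) * weightedEnergy m φ s p q)
    (Continuous.intervalIntegrable (by fun_prop) _ _)
    (Continuous.intervalIntegrable (by fun_prop) _ _) (hs φ hφ)
  refine this.trans ?_
  have hT := weightedEnergy_nonneg m φ (s := s) (show p ≤ q by linarith)
  rw [intervalIntegral.integral_const, smul_eq_mul, ← mul_assoc]
  gcongr
  rw [mul_div_assoc', div_le_iff₀ hL]
  nlinarith

lemma negligibleMass_of_strictMonoOn_of_monotoneOn {m : ℝ → ℝ} (hm : Continuous m) {p q r : ℝ}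
    (hpq : p < q) (hqr : q < r) (hmono : StrictMonoOn m (Icc p q))
    (hmono' : MonotoneOn m (Icc p r)) : NegligibleMass m p r p q := fun η hη => by
  set C := 2 / (r - q) + 2 * (r - p) with hC
  have hqr' : 0 < r - q := sub_pos.2 hqr
  have hpr : 0 < r - p := by linarith
  have hC0 : 0 < C := by positivity
  obtain ⟨δ, hδ0, hδη, hδq⟩ : ∃ δ > 0, C * δ ≤ η / 2 ∧ p ≤ q - δ := by
    refine ⟨min (η / 2 / C) (q - p), lt_min (by positivity) (by linarith), ?_, ?_⟩
    · calc C * min (η / 2 / C) (q - p) ≤ C * (η / 2 / C) := by gcongr; exact min_le_left _ _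
        _ = η / 2 := by field_simp
    · linarith [min_le_right (η / 2 / C) (q - p)]
  filter_upwards [eventually_ge_atTop 0, negligibleMass_of_strictMonoOn hm hδq
    (show q - δ < q by linarith) hmono (η / 2) (half_pos hη)] with s hs hmass φ hφ
  have h0 := hφ.continuous
  have h1 := hφ.continuous_deriv le_rfl
  have hT0 := weightedEnergy_nonneg m φ (s := s) (show p ≤ r by linarith)
  set T := weightedEnergy m φ s p r
  have hpt : ∀ x ∈ Icc (q - δ) q, Real.exp (2 * s * m x) * (φ x) ^ 2 ≤ C * T := fun x hx => by
    have hpx : p ≤ x := by linarith [hx.1]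
    have key := weighted_sq_mul_le hm hφ hs (γ := 0) hx.2 hqr.le
      (hmono'.mono (Icc_subset_Icc hpx le_rfl)) (fun y hy => by
        simpa using hmono' ⟨hpx, by linarith [hx.2]⟩ ⟨by linarith [hy.1], hy.2⟩ (hx.2.trans hy.1))
    have hT1 : weightedEnergy m φ s q r ≤ T := weightedEnergy_mono hm hφ hpq.le hqr.le le_rfl
    have hT2 : weightedEnergy m φ s x r ≤ T :=
      weightedEnergy_mono hm hφ hpx (by linarith [hx.2]) le_rfl
    have hT3 := weightedEnergy_nonneg m φ (s := s) (show x ≤ r by linarith [hx.2])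
    have hxr : 0 ≤ r - x := by linarith [hx.2]
    have hB : 2 * (r - x) * (r - q) * weightedEnergy m φ s x r ≤ 2 * (r - p) * (r - q) * T := by
      gcongr
    have : (r - q) * (Real.exp (2 * s * m x) * (φ x) ^ 2) ≤ (r - q) * (C * T) := by
      have e : (r - q) * (C * T) = 2 * T + 2 * (r - p) * (r - q) * T := by
        rw [hC]; field_simp
      rw [e]
      simp only [mul_zero, neg_zero, Real.exp_zero, mul_one] at key
      linarith
    exact le_of_mul_le_mul_left this hqr'
  have hnear := intervalIntegral.integral_mono_on (μ := volume)
    (show q - δ ≤ q by linarith) (g := fun _ => C * T)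
    (Continuous.intervalIntegrable (by fun_prop) _ _)
    (Continuous.intervalIntegrable (by fun_prop) _ _) hpt
  rw [intervalIntegral.integral_const, smul_eq_mul, sub_sub_cancel] at hnear
  have hfar := hmass φ hφ
  have hT4 : weightedEnergy m φ s p q ≤ T := weightedEnergy_mono hm hφ le_rfl hpq.le hqr.le
  rw [← intervalIntegral.integral_add_adjacent_intervals (b := q - δ)
    (Continuous.intervalIntegrable (by fun_prop) _ _)
    (Continuous.intervalIntegrable (by fun_prop) _ _)]
  have : C * δ * T ≤ η / 2 * T := by gcongr
  nlinarith

lemma exists_forall_Icc_abs_le {f : ℝ → ℝ} (hf : Continuous f) (a b : ℝ) :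
    ∃ K, 0 ≤ K ∧ ∀ x ∈ Icc a b, |f x| ≤ K := by
  obtain ⟨K, hK⟩ := (isCompact_Icc (a := a) (b := b)).exists_bound_of_continuousOn hf.continuousOn
  exact ⟨max K 0, le_max_right _ _, fun x hx => (hK x hx).trans (le_max_left _ _)⟩

lemma neg_mul_integral_le_energy {w c φ : ℝ → ℝ} (hw : Continuous w) (hw0 : ∀ x, 0 ≤ w x)
    (hc : Continuous c) (hφ : ContDiff ℝ 1 φ) {a b K : ℝ} (hab : a ≤ b)
    (hK : ∀ x ∈ Icc a b, |c x| ≤ K) :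
    -(K * ∫ x in a..b, w x * (φ x) ^ 2) ≤
      ∫ x in a..b, w x * ((deriv φ x) ^ 2 + c x * (φ x) ^ 2) := by
  have h0 := hφ.continuous
  have h1 := hφ.continuous_deriv le_rfl
  rw [← intervalIntegral.integral_const_mul, ← intervalIntegral.integral_neg]
  refine intervalIntegral.integral_mono_on hab (Continuous.intervalIntegrable (by fun_prop) _ _)
    (Continuous.intervalIntegrable (by fun_prop) _ _) fun x hx => ?_
  have h2 : 0 ≤ w x * (φ x) ^ 2 := mul_nonneg (hw0 x) (sq_nonneg _)
  have h3 : 0 ≤ w x * (deriv φ x) ^ 2 := mul_nonneg (hw0 x) (sq_nonneg _)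
  have h4 := (abs_le.1 (hK x hx)).1
  nlinarith

lemma integral_deriv_const_mul (w c φ : ℝ → ℝ) (t a b : ℝ) :
    (∫ x in a..b, w x * ((deriv (fun y => t * φ y) x) ^ 2 + c x * (t * φ x) ^ 2)) =
      t ^ 2 * ∫ x in a..b, w x * ((deriv φ x) ^ 2 + c x * (φ x) ^ 2) := by
  rw [← intervalIntegral.integral_const_mul]
  simp only [deriv_const_mul_field]
  congr 1; ext x; ring

lemma integral_const_mul_sq (w φ : ℝ → ℝ) (t a b : ℝ) :
    (∫ x in a..b, w x * (t * φ x) ^ 2) = t ^ 2 * ∫ x in a..b, w x * (φ x) ^ 2 := by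
  rw [← intervalIntegral.integral_const_mul]
  congr 1; ext x; ring

/-- A bounded-below set of values that contains all normalized Rayleigh quotients of multiples
of `φ` bounds the Rayleigh quotient of `φ` from below by its infimum. -/
lemma sInf_mul_le_energy {w c φ : ℝ → ℝ} {a b : ℝ} {S : Set ℝ} (hS : BddBelow S)
    (hpos : 0 < ∫ x in a..b, w x * (φ x) ^ 2)
    (hmem : ∀ t : ℝ, (∫ x in a..b, w x * (t * φ x) ^ 2) = 1 →
      (∫ x in a..b, w x * ((deriv (fun y => t * φ y) x) ^ 2 + c x * (t * φ x) ^ 2)) ∈ S) :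
    sInf S * (∫ x in a..b, w x * (φ x) ^ 2) ≤
      ∫ x in a..b, w x * ((deriv φ x) ^ 2 + c x * (φ x) ^ 2) := by
  set B := ∫ x in a..b, w x * (φ x) ^ 2 with hB
  have ht : ((Real.sqrt B)⁻¹) ^ 2 = B⁻¹ := by rw [inv_pow, Real.sq_sqrt hpos.le]
  have := csInf_le hS (hmem (Real.sqrt B)⁻¹ (by
    rw [integral_const_mul_sq, ht, ← hB, inv_mul_cancel₀ hpos.ne']))
  rw [integral_deriv_const_mul, ht, inv_mul_eq_div, le_div_iff₀ hpos] at this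
  exact this

lemma bddBelow_lambdaIJ {c : ℝ → ℝ} (hc : Continuous c) (dirA dirB : Bool) {a b : ℝ}
    (hab : a ≤ b) :
    BddBelow {l : ℝ | ∃ φ : ℝ → ℝ, ContDiff ℝ 1 φ ∧
      (dirA = true → φ a = 0) ∧ (dirB = true → φ b = 0) ∧
      (∫ x in a..b, (φ x) ^ 2) = 1 ∧
      l = ∫ x in a..b, ((deriv φ x) ^ 2 + c x * (φ x) ^ 2)} := by
  obtain ⟨K, -, hK⟩ := exists_forall_Icc_abs_le hc a b
  refine ⟨-K, ?_⟩
  rintro l ⟨φ, hφ, -, -, h1, rfl⟩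
  simpa [h1] using neg_mul_integral_le_energy (w := fun _ => 1) continuous_const
    (fun _ => zero_le_one) hc hφ hab hK

lemma lambdaIJ_mul_le {c φ : ℝ → ℝ} (hc : Continuous c) {dirA dirB : Bool} {a b : ℝ} (hab : a ≤ b)
    (hφ : ContDiff ℝ 1 φ) (hA : dirA = true → φ a = 0) (hB : dirB = true → φ b = 0) :
    lambdaIJ c dirA dirB a b * (∫ x in a..b, (φ x) ^ 2) ≤
      ∫ x in a..b, ((deriv φ x) ^ 2 + c x * (φ x) ^ 2) := by
  have hnn : 0 ≤ ∫ x in a..b, (φ x) ^ 2 :=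
    intervalIntegral.integral_nonneg hab fun x _ => sq_nonneg _
  rcases hnn.eq_or_lt with h0 | hpos
  · obtain ⟨K, -, hK⟩ := exists_forall_Icc_abs_le hc a b
    have := neg_mul_integral_le_energy (w := fun _ => 1) continuous_const
      (fun _ => zero_le_one) hc hφ hab hK
    simp only [one_mul, ← h0] at this
    simpa [← h0] using this
  · have := sInf_mul_le_energy (w := fun _ => 1) (c := c) (φ := φ)
      (bddBelow_lambdaIJ hc dirA dirB hab) (by simpa using hpos) (fun t ht =>
        ⟨fun y => t * φ y, contDiff_const.mul hφ, fun h => by simp [hA h], fun h => by simp [hB h],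
          by simpa using ht, by simp⟩)
    simpa [lambdaIJ] using this

lemma bddBelow_lambdaN {m c : ℝ → ℝ} (hm : Continuous m) (hc : Continuous c) (s : ℝ) :
    BddBelow {l : ℝ | ∃ φ : ℝ → ℝ, ContDiff ℝ 1 φ ∧
      (∫ x in (0:ℝ)..1, Real.exp (2 * s * m x) * (φ x) ^ 2) = 1 ∧
      l = ∫ x in (0:ℝ)..1, Real.exp (2 * s * m x) * ((deriv φ x) ^ 2 + c x * (φ x) ^ 2)} := by
  obtain ⟨K, -, hK⟩ := exists_forall_Icc_abs_le hc 0 1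
  refine ⟨-K, ?_⟩
  rintro l ⟨φ, hφ, h1, rfl⟩
  simpa [h1] using neg_mul_integral_le_energy (w := fun x => Real.exp (2 * s * m x))
    (by fun_prop) (fun _ => (Real.exp_pos _).le) hc hφ zero_le_one hK

lemma lambdaN_mul_le {m c φ : ℝ → ℝ} (hm : Continuous m) (hc : Continuous c) (s : ℝ)
    (hφ : ContDiff ℝ 1 φ)
    (hpos : 0 < ∫ x in (0:ℝ)..1, Real.exp (2 * s * m x) * (φ x) ^ 2) :
    lambdaN m c s * (∫ x in (0:ℝ)..1, Real.exp (2 * s * m x) * (φ x) ^ 2) ≤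
      ∫ x in (0:ℝ)..1, Real.exp (2 * s * m x) * ((deriv φ x) ^ 2 + c x * (φ x) ^ 2) :=
  sInf_mul_le_energy (w := fun x => Real.exp (2 * s * m x)) (bddBelow_lambdaN hm hc s) hpos
    fun t ht => ⟨fun y => t * φ y, contDiff_const.mul hφ, ht, rfl⟩

lemma energyDensity_sub_le {K κ θ η p u k ℓ S L : ℝ} (hκ : |κ| ≤ K) (hθ : 0 < θ)
    (hθη : θ ≤ η) (hθK : K * θ ≤ η) (hk : k ^ 2 ≤ 2 / L ^ 2 * S) (hℓ : ℓ ^ 2 ≤ S) :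
    (p - k) ^ 2 + κ * (u - ℓ) ^ 2 ≤ p ^ 2 + κ * u ^ 2 + η * (p ^ 2 + u ^ 2)
      + (1 + 1 / θ) * (2 / L ^ 2 + K) * S := by
  have hK0 : 0 ≤ K := (abs_nonneg _).trans hκ
  have young : ∀ u v : ℝ, 2 * |u * v| ≤ θ * u ^ 2 + 1 / θ * v ^ 2 := fun u v => by
    rw [abs_mul]
    have e : θ * u ^ 2 + 1 / θ * v ^ 2 - 2 * (|u| * |v|) = (θ * |u| - |v|) ^ 2 / θ := by
      field_simp
      rw [← sq_abs u, ← sq_abs v]; ring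
    have : 0 ≤ (θ * |u| - |v|) ^ 2 / θ := by positivity
    linarith
  have hder : (p - k) ^ 2 ≤ (1 + θ) * p ^ 2 + (1 + 1 / θ) * k ^ 2 := by
    linarith [neg_abs_le (p * k), young p k, sub_sq p k]
  have hpot : κ * ((u - ℓ) ^ 2 - u ^ 2) ≤ K * (θ * u ^ 2 + (1 + 1 / θ) * ℓ ^ 2) := by
    refine (le_abs_self _).trans ?_
    rw [abs_mul]
    refine mul_le_mul hκ ?_ (abs_nonneg _) hK0
    have := young u ℓ
    rw [abs_le]
    constructor <;> linarith [neg_abs_le (u * ℓ), le_abs_self (u * ℓ), sq_nonneg ℓ, sub_sq u ℓ,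
      mul_nonneg hθ.le (sq_nonneg u), mul_nonneg (one_div_pos.2 hθ).le (sq_nonneg ℓ)]
  have h3 : K * θ * u ^ 2 ≤ η * u ^ 2 := by gcongr
  have h4 : θ * p ^ 2 ≤ η * p ^ 2 := by gcongr
  have h5 : (1 + 1 / θ) * k ^ 2 + K * ((1 + 1 / θ) * ℓ ^ 2) ≤
      (1 + 1 / θ) * (2 / L ^ 2 + K) * S := by
    calc (1 + 1 / θ) * k ^ 2 + K * ((1 + 1 / θ) * ℓ ^ 2)
        ≤ (1 + 1 / θ) * (2 / L ^ 2 * S) + K * ((1 + 1 / θ) * S) := by gcongr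
      _ = _ := by ring
  linarith

/-- The variational inequality for `lambdaIJ`, for functions that only approximately satisfy the
Dirichlet conditions. -/
lemma exists_lambdaIJ_mul_le_add {c : ℝ → ℝ} (hc : Continuous c) (dirA dirB : Bool) {a b : ℝ}
    (hab : a < b) {η : ℝ} (hη : 0 < η) :
    ∃ C, 0 ≤ C ∧ ∀ φ : ℝ → ℝ, ContDiff ℝ 1 φ →
      lambdaIJ c dirA dirB a b * (∫ x in a..b, (φ x) ^ 2) ≤
        (∫ x in a..b, ((deriv φ x) ^ 2 + c x * (φ x) ^ 2))
          + η * (∫ x in a..b, ((deriv φ x) ^ 2 + (φ x) ^ 2))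
          + C * ((if dirA then φ a else 0) ^ 2 + (if dirB then φ b else 0) ^ 2) := by
  set Λ := lambdaIJ c dirA dirB a b with hΛ
  obtain ⟨K, hK0, hK⟩ := exists_forall_Icc_abs_le (hc.sub (continuous_const (y := Λ))) a b
  replace hK : ∀ x ∈ Icc a b, |c x - Λ| ≤ K := hK
  have hL : 0 < b - a := sub_pos.2 hab
  set θ := η / (K + 1) with hθ
  have hθ0 : 0 < θ := by positivity
  have hθη : θ ≤ η := div_le_self hη.le (by linarith)
  have hθK : K * θ ≤ η := by
    rw [hθ, mul_div_assoc', div_le_iff₀ (by linarith)]; nlinarith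
  set D := (1 + 1 / θ) * (2 / (b - a) ^ 2 + K) with hD
  refine ⟨(b - a) * D, by positivity, fun φ hφ => ?_⟩
  have h0 := hφ.continuous
  have h1 := hφ.continuous_deriv le_rfl
  set α := if dirA then φ a else 0 with hα
  set β := if dirB then φ b else 0 with hβ
  set k := (β - α) / (b - a) with hk
  set ψ : ℝ → ℝ := fun x => φ x - (α + k * (x - a)) with hψ
  have hψC : ContDiff ℝ 1 ψ := by fun_prop
  have hdψ : ∀ x, deriv ψ x = deriv φ x - k := fun x => by
    have hd : HasDerivAt φ (deriv φ x) x := (hφ.differentiable one_ne_zero x).hasDerivAt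
    have hl : HasDerivAt (fun x => α + k * (x - a)) k x := by
      simpa using (((hasDerivAt_id x).sub_const a).const_mul k).const_add α
    exact (hd.sub hl).deriv
  have hkb : α + k * (b - a) = β := by rw [hk]; field_simp; ring
  have hvar := lambdaIJ_mul_le (dirA := dirA) (dirB := dirB) hc hab.le hψC
    (fun h => by simp [hψ, hα, h]) (fun h => by simp only [hψ, hkb]; simp [hβ, h])
  rw [← hΛ] at hvar
  have hpt : ∀ x ∈ Icc a b, (deriv ψ x) ^ 2 + c x * (ψ x) ^ 2 - Λ * (ψ x) ^ 2 ≤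
      (deriv φ x) ^ 2 + c x * (φ x) ^ 2 - Λ * (φ x) ^ 2 + η * ((deriv φ x) ^ 2 + (φ x) ^ 2)
        + D * (α ^ 2 + β ^ 2) := by
    intro x hx
    rw [hdψ]
    set ℓ := α + k * (x - a) with hℓ
    have hψx : ψ x = φ x - ℓ := rfl
    have hk2 : k ^ 2 ≤ 2 / (b - a) ^ 2 * (α ^ 2 + β ^ 2) := by
      rw [hk, div_pow, div_mul_eq_mul_div]
      gcongr
      nlinarith [sq_nonneg (β + α)]
    have hℓ2 : ℓ ^ 2 ≤ α ^ 2 + β ^ 2 := by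
      set τ := (x - a) / (b - a) with hτ
      have hτ0 : 0 ≤ τ := div_nonneg (by linarith [hx.1]) hL.le
      have hτ1 : τ ≤ 1 := by rw [hτ, div_le_one hL]; linarith [hx.2]
      have e : ℓ = (1 - τ) * α + τ * β := by rw [hℓ, hk, hτ]; field_simp; ring
      have h1 : ℓ ^ 2 ≤ (1 - τ) * α ^ 2 + τ * β ^ 2 := by
        rw [e]; nlinarith [mul_nonneg (mul_nonneg hτ0 (sub_nonneg.2 hτ1)) (sq_nonneg (α - β))]
      nlinarith [sq_nonneg α, sq_nonneg β]
    have := energyDensity_sub_le (p := deriv φ x) (u := φ x) (hK x hx) hθ0 hθη hθK hk2 hℓ2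
    rw [← hD] at this
    rw [hψx]
    linarith
  have hψ0 := hψC.continuous
  have hψ1 := hψC.continuous_deriv le_rfl
  have hmean := intervalIntegral.integral_mono_on (μ := volume) hab.le
    (Continuous.intervalIntegrable (by fun_prop) _ _)
    (Continuous.intervalIntegrable (by fun_prop) _ _) hpt
  have hi : ∀ {f : ℝ → ℝ}, Continuous f → IntervalIntegrable f volume a b :=
    fun hf => hf.intervalIntegrable _ _
  have e₁ : (∫ x in a..b, ((deriv ψ x) ^ 2 + c x * (ψ x) ^ 2 - Λ * (ψ x) ^ 2)) =
      (∫ x in a..b, ((deriv ψ x) ^ 2 + c x * (ψ x) ^ 2)) - Λ * ∫ x in a..b, (ψ x) ^ 2 := by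
    rw [intervalIntegral.integral_sub (hi (by fun_prop)) (hi (by fun_prop)),
      intervalIntegral.integral_const_mul]
  have e₂ : (∫ x in a..b, ((deriv φ x) ^ 2 + c x * (φ x) ^ 2 - Λ * (φ x) ^ 2
        + η * ((deriv φ x) ^ 2 + (φ x) ^ 2) + D * (α ^ 2 + β ^ 2))) =
      (∫ x in a..b, ((deriv φ x) ^ 2 + c x * (φ x) ^ 2)) - Λ * (∫ x in a..b, (φ x) ^ 2)
        + η * (∫ x in a..b, ((deriv φ x) ^ 2 + (φ x) ^ 2))
        + (b - a) * (D * (α ^ 2 + β ^ 2)) := by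
    rw [intervalIntegral.integral_add (hi (by fun_prop)) (hi (by fun_prop)),
      intervalIntegral.integral_add (hi (by fun_prop)) (hi (by fun_prop)),
      intervalIntegral.integral_sub (hi (by fun_prop)) (hi (by fun_prop)),
      intervalIntegral.integral_const_mul, intervalIntegral.integral_const_mul,
      intervalIntegral.integral_const, smul_eq_mul]
  rw [e₁, e₂] at hmean
  linarith

lemma asymptoticLowerBound_of_const {m c : ℝ → ℝ} (hm : Continuous m) (hc : Continuous c)
    {dirA dirB : Bool} {Λ l r a b M : ℝ} (hla : l ≤ a) (hab : a < b) (hbr : b ≤ r)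
    (hM : ∀ x ∈ Icc a b, m x = M) (hA : dirA = true → NegligibleAt m l r a)
    (hB : dirB = true → NegligibleAt m l r b) (hΛ : Λ ≤ lambdaIJ c dirA dirB a b) :
    AsymptoticLowerBound m c Λ l r a b := fun η hη => by
  obtain ⟨C, hC0, hC⟩ := exists_lambdaIJ_mul_le_add hc dirA dirB hab (half_pos hη)
  set θ := η / (4 * (C + 1)) with hθ
  have hθ0 : 0 < θ := by positivity
  have hCθ : C * (2 * θ) ≤ η / 2 := by
    rw [hθ, show C * (2 * (η / (4 * (C + 1)))) = (η / 2) * (C / (C + 1)) by field_simp; norm_num]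
    exact mul_le_of_le_one_right (by linarith) ((div_le_one (by linarith)).2 (by linarith))
  have hA' : ∀ᶠ s in atTop, ∀ φ : ℝ → ℝ, ContDiff ℝ 1 φ →
      Real.exp (2 * s * m a) * (if dirA then φ a else 0) ^ 2 ≤ θ * weightedEnergy m φ s l r := by
    cases dirA
    · refine Eventually.of_forall fun s φ _ => ?_
      have := weightedEnergy_nonneg m φ (s := s) (show l ≤ r by linarith)
      simp; positivity
    · simpa using hA rfl θ hθ0
  have hB' : ∀ᶠ s in atTop, ∀ φ : ℝ → ℝ, ContDiff ℝ 1 φ →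
      Real.exp (2 * s * m b) * (if dirB then φ b else 0) ^ 2 ≤ θ * weightedEnergy m φ s l r := by
    cases dirB
    · refine Eventually.of_forall fun s φ _ => ?_
      have := weightedEnergy_nonneg m φ (s := s) (show l ≤ r by linarith)
      simp; positivity
    · simpa using hB rfl θ hθ0
  filter_upwards [hA', hB'] with s hsA hsB φ hφ
  have h0 := hφ.continuous
  have h1 := hφ.continuous_deriv le_rfl
  have hi : ∀ {f : ℝ → ℝ}, Continuous f → IntervalIntegrable f volume a b :=
    fun hf => hf.intervalIntegrable _ _
  have hsA := hsA φ hφ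
  have hsB := hsB φ hφ
  rw [hM a ⟨le_rfl, hab.le⟩] at hsA
  rw [hM b ⟨hab.le, le_rfl⟩] at hsB
  set W := Real.exp (2 * s * M) with hW
  have hW0 : 0 < W := Real.exp_pos _
  have hconst : ∀ g : ℝ → ℝ, (∫ x in a..b, Real.exp (2 * s * m x) * g x) =
      W * ∫ x in a..b, g x := fun g => by
    rw [← intervalIntegral.integral_const_mul]
    refine intervalIntegral.integral_congr fun x hx => ?_
    rw [uIcc_of_le hab.le] at hx
    simp only [hM x hx, hW]
  have hT : W * (∫ x in a..b, ((deriv φ x) ^ 2 + (φ x) ^ 2)) ≤ weightedEnergy m φ s l r := by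
    rw [← hconst]; exact weightedEnergy_mono hm hφ hla hab.le hbr
  have hT0 := weightedEnergy_nonneg m φ (s := s) (show l ≤ r by linarith)
  set T := weightedEnergy m φ s l r
  rw [hconst]
  have hmass : 0 ≤ ∫ x in a..b, (φ x) ^ 2 :=
    intervalIntegral.integral_nonneg hab.le fun x _ => sq_nonneg _
  have hsplit : (∫ x in a..b, ((deriv φ x) ^ 2 + (c x - Λ) * (φ x) ^ 2)) =
      (∫ x in a..b, ((deriv φ x) ^ 2 + c x * (φ x) ^ 2)) - Λ * ∫ x in a..b, (φ x) ^ 2 := by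
    rw [← intervalIntegral.integral_const_mul,
      ← intervalIntegral.integral_sub (hi (by fun_prop)) (hi (by fun_prop))]
    congr 1; ext x; ring
  have hvar := hC φ hφ
  have h2 : Λ * (∫ x in a..b, (φ x) ^ 2) ≤ lambdaIJ c dirA dirB a b * ∫ x in a..b, (φ x) ^ 2 := by
    gcongr
  have h3 := mul_le_mul_of_nonneg_left (h2.trans hvar) hW0.le
  have h4 : C * (W * (if dirA then φ a else 0) ^ 2 + W * (if dirB then φ b else 0) ^ 2) ≤
      C * (θ * T + θ * T) := by gcongr
  have h5 : C * (2 * θ) * T ≤ η / 2 * T := by gcongr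
  rw [hsplit]
  nlinarith

lemma AsymptoticLowerBound.of_negligibleMass {m c : ℝ → ℝ} (hm : Continuous m) (hc : Continuous c)
    {Λ l r u v : ℝ} (hlr : l ≤ r) (huv : u ≤ v) (h : NegligibleMass m l r u v) :
    AsymptoticLowerBound m c Λ l r u v := fun η hη => by
  obtain ⟨K, hK0, hK⟩ := exists_forall_Icc_abs_le (hc.sub (continuous_const (y := Λ))) u v
  filter_upwards [h (η / (K + 1)) (by positivity)] with s hs φ hφ
  have hlow := neg_mul_integral_le_energy (w := fun x => Real.exp (2 * s * m x)) (by fun_prop)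
    (fun _ => (Real.exp_pos _).le) (hc.sub continuous_const) hφ huv hK
  refine le_trans ?_ hlow
  have hT0 := weightedEnergy_nonneg m φ (s := s) hlr
  have h1 := mul_le_mul_of_nonneg_left (hs φ hφ) hK0
  have h2 : K * (η / (K + 1) * weightedEnergy m φ s l r) ≤ η * weightedEnergy m φ s l r := by
    rw [← mul_assoc]
    gcongr
    rw [mul_div_assoc', div_le_iff₀ (by linarith)]
    nlinarith
  linarith

lemma asymptoticLowerBound_of_strictMonoOn {m c : ℝ → ℝ} (hm : Continuous m) (hc : Continuous c)
    {Λ p q : ℝ} (hpq : p < q) (hmono : StrictMonoOn m (Icc p q)) (hΛ : Λ ≤ c q) :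
    AsymptoticLowerBound m c Λ p q p q := fun η hη => by
  obtain ⟨δ₀, hδ₀, hcδ⟩ := Metric.continuous_iff.1 hc q (η / 2) (half_pos hη)
  obtain ⟨δ, hδ0, hδ₁, hδq⟩ : ∃ δ > 0, δ < δ₀ ∧ p ≤ q - δ :=
    ⟨min (δ₀ / 2) (q - p), lt_min (by linarith) (by linarith),
      (min_le_left _ _).trans_lt (by linarith), by linarith [min_le_right (δ₀ / 2) (q - p)]⟩
  filter_upwards [AsymptoticLowerBound.of_negligibleMass hm hc (Λ := Λ) hpq.le hδq
    (negligibleMass_of_strictMonoOn hm hδq (show q - δ < q by linarith) hmono) (η / 2)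
    (half_pos hη)] with s hs φ hφ
  have h0 := hφ.continuous
  have h1 := hφ.continuous_deriv le_rfl
  rw [← intervalIntegral.integral_add_adjacent_intervals (b := q - δ)
    (Continuous.intervalIntegrable (by fun_prop) _ _)
    (Continuous.intervalIntegrable (by fun_prop) _ _)]
  have hnear : -(η / 2 * ∫ x in (q - δ)..q, Real.exp (2 * s * m x) * (φ x) ^ 2) ≤
      ∫ x in (q - δ)..q, Real.exp (2 * s * m x) *
        ((deriv φ x) ^ 2 + (c x - Λ) * (φ x) ^ 2) := by
    rw [← intervalIntegral.integral_const_mul, ← intervalIntegral.integral_neg]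
    refine intervalIntegral.integral_mono_on (by linarith)
      (Continuous.intervalIntegrable (by fun_prop) _ _)
      (Continuous.intervalIntegrable (by fun_prop) _ _) fun x hx => ?_
    have hcx := hcδ x (by rw [Real.dist_eq, abs_lt]; constructor <;> linarith [hx.1, hx.2])
    rw [Real.dist_eq, abs_lt] at hcx
    have h3 : -(η / 2) * (φ x) ^ 2 ≤ (deriv φ x) ^ 2 + (c x - Λ) * (φ x) ^ 2 := by
      nlinarith [sq_nonneg (deriv φ x), sq_nonneg (φ x), hcx.1]
    have := mul_le_mul_of_nonneg_left h3 (Real.exp_pos (2 * s * m x)).le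
    linarith
  have hmass := (weightedMass_le_energy (s := s) hm hφ (show q - δ ≤ q by linarith)).trans
    (weightedEnergy_mono hm hφ hδq (by linarith) le_rfl)
  have := hs φ hφ
  nlinarith

lemma eventually_le_lambdaN {m c : ℝ → ℝ} (hm : Continuous m) (hc : Continuous c) {Λ : ℝ}
    (h : AsymptoticLowerBound m c Λ 0 1 0 1) {ε : ℝ} (hε : 0 < ε) :
    ∀ᶠ s in atTop, Λ - ε ≤ lambdaN m c s := by
  obtain ⟨K, hK0, hK⟩ := exists_forall_Icc_abs_le hc 0 1
  have hD : 0 < |Λ| + K + 1 := by positivity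
  filter_upwards [h (ε / (|Λ| + K + 1)) (by positivity)] with s hs
  refine le_csInf ?_ ?_
  · have hpos : 0 < ∫ x in (0:ℝ)..1, Real.exp (2 * s * m x) :=
      intervalIntegral.intervalIntegral_pos_of_pos
        (Continuous.intervalIntegrable (by fun_prop) _ _) (fun _ => Real.exp_pos _) one_pos
    refine ⟨_, fun _ => (Real.sqrt (∫ x in (0:ℝ)..1, Real.exp (2 * s * m x)))⁻¹,
      contDiff_const, ?_, rfl⟩
    rw [intervalIntegral.integral_mul_const, inv_pow, Real.sq_sqrt hpos.le,
      mul_inv_cancel₀ hpos.ne']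
  rintro l ⟨φ, hφ, hB, rfl⟩
  have h0 := hφ.continuous
  have h1 := hφ.continuous_deriv le_rfl
  have hi : ∀ {f : ℝ → ℝ}, Continuous f → IntervalIntegrable f volume 0 1 :=
    fun hf => hf.intervalIntegrable _ _
  have hlow := hs φ hφ
  set E := ∫ x in (0:ℝ)..1, Real.exp (2 * s * m x) * ((deriv φ x) ^ 2 + c x * (φ x) ^ 2) with hE
  have hsplit : (∫ x in (0:ℝ)..1,
      Real.exp (2 * s * m x) * ((deriv φ x) ^ 2 + (c x - Λ) * (φ x) ^ 2)) = E - Λ := by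
    have : (∫ x in (0:ℝ)..1,
        Real.exp (2 * s * m x) * ((deriv φ x) ^ 2 + (c x - Λ) * (φ x) ^ 2)) =
        E - Λ * ∫ x in (0:ℝ)..1, Real.exp (2 * s * m x) * (φ x) ^ 2 := by
      rw [← intervalIntegral.integral_const_mul, hE,
        ← intervalIntegral.integral_sub (hi (by fun_prop)) (hi (by fun_prop))]
      congr 1; ext x; ring
    rw [this, hB, mul_one]
  have hT : weightedEnergy m φ s 0 1 ≤ E + K + 1 := by
    have : weightedEnergy m φ s 0 1 ≤ E + (K + 1) *
        ∫ x in (0:ℝ)..1, Real.exp (2 * s * m x) * (φ x) ^ 2 := by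
      rw [weightedEnergy, ← intervalIntegral.integral_const_mul, hE,
        ← intervalIntegral.integral_add (hi (by fun_prop)) (hi (by fun_prop))]
      refine intervalIntegral.integral_mono_on zero_le_one (hi (by fun_prop)) (hi (by fun_prop))
        fun x hx => ?_
      have h4 := (abs_le.1 (hK x hx)).1
      have h2 : 0 ≤ Real.exp (2 * s * m x) * (φ x) ^ 2 := by positivity
      nlinarith
    rw [hB] at this
    linarith
  rw [hsplit] at hlow
  by_contra! hlt
  have hEΛ : E + K + 1 ≤ |Λ| + K + 1 := by linarith [le_abs_self Λ]
  have h5 : ε / (|Λ| + K + 1) * weightedEnergy m φ s 0 1 ≤ ε / (|Λ| + K + 1) * (|Λ| + K + 1) := by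
    gcongr; linarith
  rw [div_mul_cancel₀ _ hD.ne'] at h5
  linarith

lemma tendsto_integral_exp_mul_of_const {m g : ℝ → ℝ} (hm : Continuous m) (hg : Continuous g)
    {p q M : ℝ} (hp : 0 < p) (hpq : p ≤ q) (hq : q ≤ 1) (hM : ∀ x ∈ Icc p q, m x = M)
    (hoff : ∀ x ∈ Icc (0:ℝ) 1, x ∉ Icc p q → g x = 0 ∨ m x < M) :
    Tendsto (fun s : ℝ => ∫ x in (0:ℝ)..1, Real.exp (2 * s * (m x - M)) * g x) atTop
      (nhds (∫ x in p..q, g x)) := by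
  have hlim : (∫ x in p..q, g x) = ∫ x in (0:ℝ)..1, (Icc p q).indicator g x := by
    rw [intervalIntegral.integral_of_le zero_le_one, intervalIntegral.integral_of_le hpq,
      setIntegral_indicator measurableSet_Icc, inter_eq_self_of_subset_right,
      integral_Icc_eq_integral_Ioc]
    exact fun x hx => ⟨hp.trans_le hx.1, hx.2.trans hq⟩
  have hle : ∀ x ∈ Icc (0:ℝ) 1, g x = 0 ∨ m x ≤ M := fun x hx => by
    by_cases hx' : x ∈ Icc p q
    · exact Or.inr (hM x hx').le
    · exact (hoff x hx hx').imp_right le_of_lt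
  rw [hlim]
  refine intervalIntegral.tendsto_integral_filter_of_dominated_convergence (fun x => |g x|)
    ?_ ?_ (hg.abs.intervalIntegrable _ _) ?_
  · exact Eventually.of_forall fun s => Continuous.aestronglyMeasurable (by fun_prop)
  · filter_upwards [eventually_ge_atTop 0] with s hs
    refine Eventually.of_forall fun x hx => ?_
    rw [uIoc_of_le zero_le_one] at hx
    rw [Real.norm_eq_abs, abs_mul, Real.abs_exp]
    rcases hle x (Ioc_subset_Icc_self hx) with h | h
    · simp [h]
    · refine mul_le_of_le_one_left (abs_nonneg _) (Real.exp_le_one_iff.2 ?_)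
      exact mul_nonpos_of_nonneg_of_nonpos (by positivity) (by linarith)
  · refine Eventually.of_forall fun x hx => ?_
    rw [uIoc_of_le zero_le_one] at hx
    by_cases hx' : x ∈ Icc p q
    · simp [hx', hM x hx']
    · rw [indicator_of_notMem hx']
      rcases hoff x (Ioc_subset_Icc_self hx) hx' with h | h
      · simp [h]
      · rw [← zero_mul (g x)]
        refine Tendsto.mul_const _ (Real.tendsto_exp_atBot.comp ?_)
        exact (tendsto_id.const_mul_atTop two_pos).atTop_mul_const_of_neg (sub_neg.2 h)

lemma eventually_lambdaN_le_of_const {m c ψ : ℝ → ℝ} (hm : Continuous m) (hc : Continuous c)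
    {p q M R : ℝ} (hp : 0 < p) (hpq : p ≤ q) (hq : q ≤ 1) (hM : ∀ x ∈ Icc p q, m x = M)
    (hψ : ContDiff ℝ 1 ψ)
    (hoff : ∀ x ∈ Icc (0:ℝ) 1, x ∉ Icc p q → (ψ x = 0 ∧ deriv ψ x = 0) ∨ m x < M)
    (hpos : 0 < ∫ x in p..q, (ψ x) ^ 2)
    (hR : (∫ x in p..q, ((deriv ψ x) ^ 2 + c x * (ψ x) ^ 2)) < R * ∫ x in p..q, (ψ x) ^ 2) :
    ∀ᶠ s in atTop, lambdaN m c s ≤ R := by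
  have h0 := hψ.continuous
  have h1 := hψ.continuous_deriv le_rfl
  have hmass := tendsto_integral_exp_mul_of_const hm (g := fun x => (ψ x) ^ 2) (by fun_prop)
    hp hpq hq hM fun x hx hx' => (hoff x hx hx').imp_left fun h => by simp [h.1]
  have henergy := tendsto_integral_exp_mul_of_const hm
    (g := fun x => (deriv ψ x) ^ 2 + c x * (ψ x) ^ 2) (by fun_prop)
    hp hpq hq hM fun x hx hx' => (hoff x hx hx').imp_left fun h => by simp [h.1, h.2]
  filter_upwards [hmass.eventually_const_lt hpos, henergy.eventually_lt (hmass.const_mul R) hR]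
    with s hs₁ hs₂
  have hscale : ∀ g : ℝ → ℝ, (∫ x in (0:ℝ)..1, Real.exp (2 * s * m x) * g x) =
      Real.exp (2 * s * M) * ∫ x in (0:ℝ)..1, Real.exp (2 * s * (m x - M)) * g x := fun g => by
    rw [← intervalIntegral.integral_const_mul]
    congr 1; ext x
    rw [← mul_assoc, ← Real.exp_add]
    ring_nf
  have hE := Real.exp_pos (2 * s * M)
  have hB : 0 < ∫ x in (0:ℝ)..1, Real.exp (2 * s * m x) * (ψ x) ^ 2 := by
    rw [hscale]; exact mul_pos hE hs₁
  refine le_of_mul_le_mul_right ((lambdaN_mul_le hm hc s hψ hB).trans ?_) hB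
  rw [hscale, hscale, mul_left_comm]
  exact mul_le_mul_of_nonneg_left hs₂.le hE.le

lemma exists_contDiff_bump {a δ : ℝ} (hδ : 0 < δ) :
    ∃ ψ : ℝ → ℝ, ContDiff ℝ 1 ψ ∧ (∀ x, |x - a| ≤ δ → ψ x = 1) ∧
      (∀ x, |x - a| < δ → deriv ψ x = 0) ∧ ∀ x, 2 * δ < |x - a| → ψ x = 0 ∧ deriv ψ x = 0 := by
  let f : ContDiffBump a := ⟨δ, 2 * δ, hδ, by linarith⟩
  have hout : ∀ x, 2 * δ < |x - a| → f x = 0 := fun x hx =>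
    f.zero_of_le_dist (by rw [Real.dist_eq]; exact hx.le)
  have hin : ∀ x, |x - a| ≤ δ → f x = 1 := fun x hx =>
    f.one_of_mem_closedBall (by rw [Metric.mem_closedBall, Real.dist_eq]; exact hx)
  have hcont : Continuous fun x : ℝ => |x - a| := by fun_prop
  refine ⟨f, f.contDiff, hin, fun x hx => ?_, fun x hx => ⟨hout x hx, ?_⟩⟩
  · have : (f : ℝ → ℝ) =ᶠ[nhds x] fun _ => 1 := by
      filter_upwards [hcont.continuousAt.eventually_lt_const hx] with y hy using hin y hy.le
    rw [this.deriv_eq, deriv_const]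
  · have : (f : ℝ → ℝ) =ᶠ[nhds x] fun _ => 0 := by
      filter_upwards [hcont.continuousAt.eventually_const_lt hx] with y hy using hout y hy
    rw [this.deriv_eq, deriv_const]

lemma eventually_lambdaN_le_of_strictMax {m c : ℝ → ℝ} (hm : Continuous m) (hc : Continuous c)
    {a b : ℝ} (ha : 0 < a) (hab : a < b) (hb : b ≤ 1) (hmono : StrictMonoOn m (Icc 0 a))
    (hanti : StrictAntiOn m (Icc a b)) {R : ℝ} (hR : c a < R) :
    ∀ᶠ s in atTop, lambdaN m c s ≤ R := by
  obtain ⟨η, hη0, hηR⟩ : ∃ η > 0, c a + 2 * η ≤ R := ⟨(R - c a) / 2, by linarith, by linarith⟩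
  obtain ⟨δ₀, hδ₀, hcδ⟩ := Metric.continuous_iff.1 hc a η hη0
  obtain ⟨δ, hδ, hδ₁, hδa, hδb⟩ : ∃ δ > 0, 2 * δ < δ₀ ∧ 2 * δ ≤ a ∧ a + 2 * δ ≤ b := by
    refine ⟨min (δ₀ / 3) (min (a / 2) ((b - a) / 2)), by
      refine lt_min (by linarith) (lt_min (by linarith) (by linarith)), ?_, ?_, ?_⟩
    · linarith [min_le_left (δ₀ / 3) (min (a / 2) ((b - a) / 2))]
    · linarith [min_le_right (δ₀ / 3) (min (a / 2) ((b - a) / 2)),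
        min_le_left (a / 2) ((b - a) / 2)]
    · linarith [min_le_right (δ₀ / 3) (min (a / 2) ((b - a) / 2)),
        min_le_right (a / 2) ((b - a) / 2)]
  obtain ⟨ψ, hψ, hin, hdin, hout⟩ := exists_contDiff_bump (a := a) hδ
  have h0 := hψ.continuous
  have h1 := hψ.continuous_deriv le_rfl
  set μ := max (m (a - δ)) (m (a + δ)) with hμ
  have hμa : μ < m a := max_lt
    (hmono ⟨by linarith, by linarith⟩ ⟨ha.le, le_rfl⟩ (by linarith))
    (hanti ⟨le_rfl, hab.le⟩ ⟨by linarith, by linarith⟩ (by linarith))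
  have hfar : ∀ x ∈ Icc (0:ℝ) 1, deriv ψ x = 0 ∨ m x ≤ μ := fun x hx => by
    by_cases hx1 : |x - a| < δ
    · exact Or.inl (hdin x hx1)
    by_cases hx2 : 2 * δ < |x - a|
    · exact Or.inl (hout x hx2).2
    right
    push Not at hx1 hx2
    rw [abs_le] at hx2
    rcases le_abs.1 hx1 with h | h
    · exact (hanti.antitoneOn ⟨by linarith, by linarith⟩ ⟨by linarith, by linarith⟩
        (by linarith)).trans (le_max_right _ _)
    · exact (hmono.monotoneOn ⟨hx.1, by linarith⟩ ⟨by linarith, by linarith⟩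
        (by linarith)).trans (le_max_left _ _)
  obtain ⟨ρ, hρ, hρδ, hρm⟩ : ∃ ρ > 0, ρ ≤ δ ∧ ∀ x, |x - a| ≤ ρ → (μ + m a) / 2 ≤ m x := by
    obtain ⟨r, hr, hrm⟩ := Metric.continuous_iff.1 hm a ((m a - μ) / 2) (by linarith)
    refine ⟨min (r / 2) δ, lt_min (by linarith) hδ, min_le_right _ _, fun x hx => ?_⟩
    have := hrm x (by rw [Real.dist_eq]; linarith [min_le_left (r / 2) δ])
    rw [Real.dist_eq, abs_lt] at this
    linarith
  set D := ∫ x in (0:ℝ)..1, (deriv ψ x) ^ 2 with hD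
  have hlim : Tendsto (fun s : ℝ => η * (2 * ρ * Real.exp (s * (m a - μ)))) atTop atTop := by
    refine Tendsto.const_mul_atTop hη0 (Tendsto.const_mul_atTop (by positivity) ?_)
    exact Real.tendsto_exp_atTop.comp (tendsto_id.atTop_mul_const (sub_pos.2 hμa))
  filter_upwards [eventually_ge_atTop 0, hlim.eventually_ge_atTop D] with s hs hsD
  have hi : ∀ {f : ℝ → ℝ}, Continuous f → ∀ u v, IntervalIntegrable f volume u v :=
    fun hf u v => hf.intervalIntegrable u v
  have hE := Real.exp_pos (2 * s * μ)
  have hder : (∫ x in (0:ℝ)..1, Real.exp (2 * s * m x) * (deriv ψ x) ^ 2) ≤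
      Real.exp (2 * s * μ) * D := by
    rw [hD, ← intervalIntegral.integral_const_mul]
    refine intervalIntegral.integral_mono_on zero_le_one (hi (by fun_prop) _ _)
      (hi (by fun_prop) _ _) fun x hx => ?_
    rcases hfar x hx with h | h
    · simp [h]
    · gcongr
  set B := ∫ x in (0:ℝ)..1, Real.exp (2 * s * m x) * (ψ x) ^ 2 with hB
  have hBlow : Real.exp (2 * s * μ) * (2 * ρ * Real.exp (s * (m a - μ))) ≤ B := by
    calc Real.exp (2 * s * μ) * (2 * ρ * Real.exp (s * (m a - μ)))
        = ∫ _x in (a - ρ)..(a + ρ), Real.exp (2 * s * ((μ + m a) / 2)) := by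
          rw [intervalIntegral.integral_const, smul_eq_mul, mul_left_comm, ← Real.exp_add]
          ring_nf
      _ ≤ ∫ x in (a - ρ)..(a + ρ), Real.exp (2 * s * m x) * (ψ x) ^ 2 := by
          refine intervalIntegral.integral_mono_on (by linarith) (hi (by fun_prop) _ _)
            (hi (by fun_prop) _ _) fun x hx => ?_
          have hx' : |x - a| ≤ ρ := abs_le.2 ⟨by linarith [hx.1], by linarith [hx.2]⟩
          have := hρm x hx'
          rw [hin x (hx'.trans hρδ), one_pow, mul_one]
          gcongr
      _ ≤ B := by
          refine intervalIntegral.integral_mono_interval (by linarith) (by linarith) (by linarith)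
            (Eventually.of_forall fun x => ?_) (hi (by fun_prop) _ _)
          simp only [Pi.zero_apply]; positivity
  have hBpos : 0 < B := lt_of_lt_of_le (by positivity) hBlow
  have hpot : (∫ x in (0:ℝ)..1, Real.exp (2 * s * m x) * (c x * (ψ x) ^ 2)) ≤ (c a + η) * B := by
    rw [hB, ← intervalIntegral.integral_const_mul]
    refine intervalIntegral.integral_mono_on zero_le_one (hi (by fun_prop) _ _)
      (hi (by fun_prop) _ _) fun x _ => ?_
    by_cases hx2 : 2 * δ < |x - a|
    · simp [(hout x hx2).1]
    · push Not at hx2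
      have := hcδ x (by rw [Real.dist_eq]; linarith)
      rw [Real.dist_eq, abs_lt] at this
      have h2 : 0 ≤ Real.exp (2 * s * m x) * (ψ x) ^ 2 := by positivity
      nlinarith
  have key := lambdaN_mul_le hm hc s hψ hBpos
  simp only [mul_add] at key
  rw [intervalIntegral.integral_add (hi (by fun_prop) _ _) (hi (by fun_prop) _ _), ← hB] at key
  have hsmall : Real.exp (2 * s * μ) * D ≤ η * B := by
    calc Real.exp (2 * s * μ) * D
        ≤ Real.exp (2 * s * μ) * (η * (2 * ρ * Real.exp (s * (m a - μ)))) := by gcongr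
      _ = η * (Real.exp (2 * s * μ) * (2 * ρ * Real.exp (s * (m a - μ)))) := by ring
      _ ≤ η * B := by gcongr
  have hRB : (c a + 2 * η) * B ≤ R * B := by gcongr
  exact le_of_mul_le_mul_right (by linarith) hBpos

lemma exists_energy_lt_of_lambdaIJ_lt {c : ℝ → ℝ} {dirA dirB : Bool} {a b R : ℝ} (hab : a < b)
    (hR : lambdaIJ c dirA dirB a b < R) :
    ∃ φ : ℝ → ℝ, ContDiff ℝ 1 φ ∧ (dirA = true → φ a = 0) ∧ (dirB = true → φ b = 0) ∧
      0 < (∫ x in a..b, (φ x) ^ 2) ∧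
      (∫ x in a..b, ((deriv φ x) ^ 2 + c x * (φ x) ^ 2)) < R * ∫ x in a..b, (φ x) ^ 2 := by
  have hpos : 0 < ∫ x in a..b, ((x - a) * (b - x)) ^ 2 :=
    intervalIntegral.intervalIntegral_pos_of_pos_on
      (Continuous.intervalIntegrable (by fun_prop) _ _)
      (fun x hx => pow_pos (mul_pos (sub_pos.2 hx.1) (sub_pos.2 hx.2)) 2) hab
  have hne : {l : ℝ | ∃ φ : ℝ → ℝ, ContDiff ℝ 1 φ ∧
      (dirA = true → φ a = 0) ∧ (dirB = true → φ b = 0) ∧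
      (∫ x in a..b, (φ x) ^ 2) = 1 ∧
      l = ∫ x in a..b, ((deriv φ x) ^ 2 + c x * (φ x) ^ 2)}.Nonempty := by
    refine ⟨_, fun x => (Real.sqrt (∫ x in a..b, ((x - a) * (b - x)) ^ 2))⁻¹ *
      ((x - a) * (b - x)), by fun_prop, by simp, by simp, ?_, rfl⟩
    simp_rw [mul_pow _ (((_ : ℝ) - a) * (b - _))]
    rw [intervalIntegral.integral_const_mul, inv_pow, Real.sq_sqrt hpos.le,
      inv_mul_cancel₀ hpos.ne']
  obtain ⟨l, ⟨φ, hφ, hA, hB, h1, rfl⟩, hlt⟩ := exists_lt_of_csInf_lt hne hR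
  exact ⟨φ, hφ, hA, hB, by rw [h1]; exact one_pos, by rwa [h1, mul_one]⟩

/-- A test function may be modified so that its derivative vanishes wherever the function does. -/
lemma exists_energy_lt_deriv_eq_zero {c φ : ℝ → ℝ} (hc : Continuous c) (hφ : ContDiff ℝ 1 φ)
    {a b R : ℝ} (hab : a ≤ b) (hpos : 0 < ∫ x in a..b, (φ x) ^ 2)
    (hR : (∫ x in a..b, ((deriv φ x) ^ 2 + c x * (φ x) ^ 2)) < R * ∫ x in a..b, (φ x) ^ 2) :
    ∃ ψ : ℝ → ℝ, ContDiff ℝ 1 ψ ∧ (∀ x, φ x = 0 → ψ x = 0 ∧ deriv ψ x = 0) ∧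
      0 < (∫ x in a..b, (ψ x) ^ 2) ∧
      (∫ x in a..b, ((deriv ψ x) ^ 2 + c x * (ψ x) ^ 2)) < R * ∫ x in a..b, (ψ x) ^ 2 := by
  have h0 := hφ.continuous
  have h1 := hφ.continuous_deriv le_rfl
  set G : ℝ → ℝ → ℝ := fun r x => φ x - r * Real.arctan (φ x / r) with hG
  have hGC : ∀ r, ContDiff ℝ 1 (G r) := fun r => by
    have : ContDiff ℝ 1 fun x => Real.arctan (φ x / r) := Real.contDiff_arctan.comp (by fun_prop)
    fun_prop
  have hdG : ∀ r > 0, ∀ x, deriv (G r) x = (1 - 1 / (1 + (φ x / r) ^ 2)) * deriv φ x := by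
    intro r hr x
    have hd : HasDerivAt φ (deriv φ x) x := (hφ.differentiable one_ne_zero x).hasDerivAt
    have := hd.sub (((hd.div_const r).arctan).const_mul r)
    refine this.deriv.trans ?_
    field_simp
  have hGb : ∀ r > 0, ∀ x, |G r x - φ x| ≤ 2 * r := fun r hr x => by
    have e : G r x - φ x = -(r * Real.arctan (φ x / r)) := by simp only [hG]; ring
    rw [e, abs_neg, abs_mul, abs_of_pos hr, mul_comm]
    gcongr
    rw [abs_le]
    constructor <;> linarith [Real.neg_pi_div_two_lt_arctan (φ x / r),
      Real.arctan_lt_pi_div_two (φ x / r), Real.pi_lt_four]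
  have hGlim : ∀ x, Tendsto (fun r => G r x) (nhdsWithin 0 (Ioi 0)) (nhds (φ x)) := fun x => by
    rw [tendsto_iff_dist_tendsto_zero]
    refine squeeze_zero' (Eventually.of_forall fun r => dist_nonneg)
      (g := fun r => 2 * r) ?_ ?_
    · filter_upwards [self_mem_nhdsWithin] with r hr
      rw [Real.dist_eq]; exact hGb r hr x
    · have : Tendsto (fun r : ℝ => 2 * r) (nhds 0) (nhds (2 * 0)) := tendsto_id.const_mul 2
      rw [mul_zero] at this
      exact this.mono_left nhdsWithin_le_nhds
  have hlim : ∀ k : ℝ → ℝ, Continuous k →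
      Tendsto (fun r => ∫ x in a..b, k x * (G r x) ^ 2) (nhdsWithin 0 (Ioi 0))
        (nhds (∫ x in a..b, k x * (φ x) ^ 2)) := fun k hk => by
    refine intervalIntegral.tendsto_integral_filter_of_dominated_convergence
      (fun x => |k x| * (|φ x| + 2) ^ 2) ?_ ?_ (Continuous.intervalIntegrable (by fun_prop) _ _)
      (Eventually.of_forall fun x _ => ((hGlim x).pow 2).const_mul _)
    · refine Eventually.of_forall fun r => Continuous.aestronglyMeasurable ?_
      have := (hGC r).continuous
      fun_prop
    · filter_upwards [self_mem_nhdsWithin,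
        nhdsWithin_le_nhds (Iio_mem_nhds (zero_lt_one' ℝ))] with r hr hr1
      refine Eventually.of_forall fun x _ => ?_
      rw [Real.norm_eq_abs, abs_mul, abs_pow]
      have h2 := hGb r hr x
      have h3 : |G r x| ≤ |φ x| + 2 := by
        have := abs_sub_abs_le_abs_sub (G r x) (φ x)
        have hr1 : r < 1 := hr1
        linarith
      gcongr
  have hi : ∀ {f : ℝ → ℝ}, Continuous f → IntervalIntegrable f volume a b :=
    fun hf => hf.intervalIntegrable _ _
  have hmass := hlim (fun _ => 1) continuous_const
  have hpot := hlim (fun x => c x - R) (by fun_prop)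
  simp only [one_mul] at hmass
  have hsplit : ∀ f g : ℝ → ℝ, Continuous f → Continuous g →
      (∫ x in a..b, ((g x) ^ 2 + c x * (f x) ^ 2)) - R * (∫ x in a..b, (f x) ^ 2) =
      (∫ x in a..b, (g x) ^ 2) + ∫ x in a..b, (c x - R) * (f x) ^ 2 := fun f g hf hg => by
    rw [← intervalIntegral.integral_const_mul,
      ← intervalIntegral.integral_sub (hi (by fun_prop)) (hi (by fun_prop)),
      ← intervalIntegral.integral_add (hi (by fun_prop)) (hi (by fun_prop))]
    congr 1; ext x; ring
  have hneg : (∫ x in a..b, (c x - R) * (φ x) ^ 2) < -∫ x in a..b, (deriv φ x) ^ 2 := by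
    linarith [hsplit φ (deriv φ) h0 h1]
  obtain ⟨r, hrm, hrp, hr⟩ := ((hmass.eventually_const_lt hpos).and
    ((hpot.eventually_lt_const hneg).and self_mem_nhdsWithin)).exists
  replace hr : 0 < r := hr
  have hG0 := (hGC r).continuous
  have hG1 := (hGC r).continuous_deriv le_rfl
  refine ⟨G r, hGC r, fun x hx => ⟨by simp [hG, hx], by simp [hdG r hr x, hx]⟩, hrm, ?_⟩
  have hder : (∫ x in a..b, (deriv (G r) x) ^ 2) ≤ ∫ x in a..b, (deriv φ x) ^ 2 := by
    refine intervalIntegral.integral_mono_on hab (hi (by fun_prop)) (hi (by fun_prop))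
      fun x _ => ?_
    rw [hdG r hr x, mul_pow]
    refine mul_le_of_le_one_left (sq_nonneg _) ?_
    have h2 : 1 / (1 + (φ x / r) ^ 2) ≤ 1 :=
      (div_le_one (by positivity)).2 (by linarith [sq_nonneg (φ x / r)])
    have h3 : 0 < 1 / (1 + (φ x / r) ^ 2) := by positivity
    nlinarith
  linarith [hsplit (G r) (deriv (G r)) hG0 hG1]

lemma exists_contDiff_extend_zero {h : ℝ → ℝ} (hh : ContDiff ℝ 1 h) {a b : ℝ} (hab : a ≤ b)
    (ha : h a = 0 ∧ deriv h a = 0) (hb : h b = 0 ∧ deriv h b = 0) :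
    ∃ ψ : ℝ → ℝ, ContDiff ℝ 1 ψ ∧ (∀ x ∈ Icc a b, ψ x = h x ∧ deriv ψ x = deriv h x) ∧
      ∀ x ∉ Icc a b, ψ x = 0 ∧ deriv ψ x = 0 := by
  have h1 := hh.continuous_deriv le_rfl
  set k : ℝ → ℝ := fun t => deriv h (max a (min t b)) with hk
  have hkc : Continuous k := by fun_prop
  have hkin : ∀ t ∈ Icc a b, k t = deriv h t := fun t ht => by
    simp only [hk, min_eq_left ht.2, max_eq_right ht.1]
  have hka : ∀ t ≤ a, k t = 0 := fun t ht => by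
    simp only [hk, min_eq_left (ht.trans hab), max_eq_left ht, ha.2]
  have hkb : ∀ t ≥ b, k t = 0 := fun t ht => by
    simp only [hk, min_eq_right ht, max_eq_right hab, hb.2]
  set ψ : ℝ → ℝ := fun x => ∫ t in a..x, k t with hψ
  have hd : ∀ x, HasDerivAt ψ (k x) x := fun x => (hkc.integral_hasStrictDerivAt a x).hasDerivAt
  have hderiv : deriv ψ = k := funext fun x => (hd x).deriv
  have hin : ∀ x ∈ Icc a b, ψ x = h x := fun x hx => by
    have : ψ x = ∫ t in a..x, deriv h t :=
      intervalIntegral.integral_congr fun t ht => by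
        rw [uIcc_of_le hx.1] at ht
        exact hkin t ⟨ht.1, ht.2.trans hx.2⟩
    rw [this, intervalIntegral.integral_deriv_eq_sub
      (fun t _ => hh.differentiable one_ne_zero t) (h1.intervalIntegrable _ _), ha.1, sub_zero]
  refine ⟨ψ, contDiff_one_iff_deriv.2 ⟨fun x => (hd x).differentiableAt, hderiv ▸ hkc⟩,
    fun x hx => ⟨hin x hx, by rw [hderiv, hkin x hx]⟩, fun x hx => ?_⟩
  rw [hderiv]
  rcases lt_or_ge x a with hxa | hxa
  · refine ⟨?_, hka x hxa.le⟩
    have : ψ x = ∫ t in a..x, (0:ℝ) := intervalIntegral.integral_congr fun t ht => by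
      rw [uIcc_of_ge hxa.le] at ht
      exact hka t ht.2
    simpa using this
  · have hxb : b < x := by
      by_contra! hle
      exact hx ⟨hxa, hle⟩
    refine ⟨?_, hkb x hxb.le⟩
    have h2 : (∫ t in b..x, k t) = ∫ t in b..x, (0:ℝ) :=
      intervalIntegral.integral_congr fun t ht => by
        rw [uIcc_of_le hxb.le] at ht
        exact hkb t ht.1
    have h3 : ψ b = 0 := (hin b ⟨hab, le_rfl⟩).trans hb.1
    have h4 : ψ x = ψ b + ∫ t in b..x, k t :=
      (intervalIntegral.integral_add_adjacent_intervals (hkc.intervalIntegrable _ _)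
        (hkc.intervalIntegrable _ _)).symm
    rw [h4, h3, h2]; simp

lemma exists_contDiff_cutoff {φ : ℝ → ℝ} (hφ : ContDiff ℝ 1 φ) {l a : ℝ} (hla : l < a) :
    ∃ h : ℝ → ℝ, ContDiff ℝ 1 h ∧ (∀ x ≤ l, h x = 0 ∧ deriv h x = 0) ∧
      ∀ x ≥ a, h x = φ x ∧ deriv h x = deriv φ x := by
  set χ : ℝ → ℝ := fun x => Real.smoothTransition ((x - l) / (a - l)) with hχ
  have hal : 0 < a - l := sub_pos.2 hla
  have hχC : ContDiff ℝ 1 χ := Real.smoothTransition.contDiff.comp (by fun_prop)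
  have h0 : ∀ x ≤ l, χ x = 0 := fun x hx =>
    Real.smoothTransition.zero_of_nonpos (div_nonpos_of_nonpos_of_nonneg (by linarith) hal.le)
  have h1 : ∀ x ≥ a, χ x = 1 := fun x hx =>
    Real.smoothTransition.one_of_one_le ((one_le_div hal).2 (by linarith))
  have hd0 : ∀ x ≤ l, deriv χ x = 0 := fun x hx =>
    IsLocalMin.deriv_eq_zero (Eventually.of_forall fun y => by
      rw [h0 x hx]; exact Real.smoothTransition.nonneg _)
  have hd1 : ∀ x ≥ a, deriv χ x = 0 := fun x hx =>
    IsLocalMax.deriv_eq_zero (Eventually.of_forall fun y => by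
      rw [h1 x hx]; exact Real.smoothTransition.le_one _)
  have hd : ∀ x, deriv (fun x => χ x * φ x) x = deriv χ x * φ x + χ x * deriv φ x := fun x =>
    ((hχC.differentiable one_ne_zero x).hasDerivAt.mul
      (hφ.differentiable one_ne_zero x).hasDerivAt).deriv
  refine ⟨fun x => χ x * φ x, hχC.mul hφ, fun x hx => ?_, fun x hx => ?_⟩
  · rw [hd, h0 x hx, hd0 x hx]; simp [h0 x hx]
  · rw [hd, h1 x hx, hd1 x hx]; simp [h1 x hx]

lemma energy_congr {c φ ψ : ℝ → ℝ} {a b : ℝ} (hab : a ≤ b)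
    (h : ∀ x ∈ Icc a b, ψ x = φ x ∧ deriv ψ x = deriv φ x) :
    (∫ x in a..b, (ψ x) ^ 2) = (∫ x in a..b, (φ x) ^ 2) ∧
      (∫ x in a..b, ((deriv ψ x) ^ 2 + c x * (ψ x) ^ 2)) =
        ∫ x in a..b, ((deriv φ x) ^ 2 + c x * (φ x) ^ 2) := by
  rw [← uIcc_of_le hab] at h
  constructor <;> refine intervalIntegral.integral_congr fun x hx => ?_
  · simp only [(h x hx).1]
  · simp only [(h x hx).1, (h x hx).2]

lemma eventually_lambdaN_le_of_lambdaIJ_true_true {m c : ℝ → ℝ} (hm : Continuous m)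
    (hc : Continuous c) {a b M R : ℝ} (ha : 0 < a) (hab : a < b) (hb : b ≤ 1)
    (hM : ∀ x ∈ Icc a b, m x = M) (hR : lambdaIJ c true true a b < R) :
    ∀ᶠ s in atTop, lambdaN m c s ≤ R := by
  obtain ⟨φ, hφ, hA, hB, hpos, hlt⟩ := exists_energy_lt_of_lambdaIJ_lt hab hR
  obtain ⟨h, hh, hz, hpos, hlt⟩ := exists_energy_lt_deriv_eq_zero hc hφ hab.le hpos hlt
  obtain ⟨ψ, hψ, hin, hout⟩ :=
    exists_contDiff_extend_zero hh hab.le (hz a (hA rfl)) (hz b (hB rfl))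
  obtain ⟨e₁, e₂⟩ := energy_congr (c := c) hab.le hin
  exact eventually_lambdaN_le_of_const hm hc ha hab.le hb hM hψ
    (fun x _ hx => Or.inl (hout x hx)) (e₁ ▸ hpos) (by rwa [e₁, e₂])

lemma eventually_lambdaN_le_of_lambdaIJ_false_true {m c : ℝ → ℝ} (hm : Continuous m)
    (hc : Continuous c) {l a b M R : ℝ} (ha : 0 < a) (hla : l < a) (hab : a < b) (hb : b ≤ 1)
    (hmono : StrictMonoOn m (Icc l a)) (hM : ∀ x ∈ Icc a b, m x = M)
    (hR : lambdaIJ c false true a b < R) :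
    ∀ᶠ s in atTop, lambdaN m c s ≤ R := by
  obtain ⟨φ, hφ, -, hB, hpos, hlt⟩ := exists_energy_lt_of_lambdaIJ_lt hab hR
  obtain ⟨f, hf, hz, hpos, hlt⟩ := exists_energy_lt_deriv_eq_zero hc hφ hab.le hpos hlt
  obtain ⟨h, hh, hl, hr⟩ := exists_contDiff_cutoff hf hla
  have hhb : h b = 0 ∧ deriv h b = 0 := by
    rw [(hr b hab.le).1, (hr b hab.le).2]; exact hz b (hB rfl)
  obtain ⟨ψ, hψ, hin, hout⟩ := exists_contDiff_extend_zero hh (hla.trans hab).le (hl l le_rfl) hhb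
  obtain ⟨e₁, e₂⟩ := energy_congr (c := c) (φ := f) (ψ := ψ) hab.le fun x hx => by
    obtain ⟨h1, h2⟩ := hin x ⟨hla.le.trans hx.1, hx.2⟩
    rw [h1, h2]; exact hr x hx.1
  refine eventually_lambdaN_le_of_const hm hc ha hab.le hb hM hψ
    (fun x _ hx => ?_) (e₁ ▸ hpos) (by rwa [e₁, e₂])
  by_cases hx' : x ∈ Icc l b
  · have hxa : x < a := by
      by_contra! hle
      exact hx ⟨hle, hx'.2⟩
    right
    rw [← hM a ⟨le_rfl, hab.le⟩]
    exact hmono ⟨hx'.1, hxa.le⟩ ⟨hla.le, le_rfl⟩ hxa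
  · exact Or.inl (hout x hx')

lemma eventually_lambdaN_le_of_lambdaIJ_false_false {m c : ℝ → ℝ} (hm : Continuous m)
    (hc : Continuous c) {l a M R : ℝ} (ha : 0 < a) (hla : l < a) (ha1 : a < 1)
    (hmono : StrictMonoOn m (Icc l a)) (hM : ∀ x ∈ Icc a 1, m x = M)
    (hR : lambdaIJ c false false a 1 < R) :
    ∀ᶠ s in atTop, lambdaN m c s ≤ R := by
  obtain ⟨φ, hφ, -, -, hpos, hlt⟩ := exists_energy_lt_of_lambdaIJ_lt ha1 hR
  obtain ⟨ψ, hψ, hl, hr⟩ := exists_contDiff_cutoff hφ hla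
  obtain ⟨e₁, e₂⟩ := energy_congr (c := c) (φ := φ) (ψ := ψ) ha1.le fun x hx => hr x hx.1
  refine eventually_lambdaN_le_of_const hm hc ha ha1.le le_rfl hM hψ
    (fun x hx01 hx => ?_) (e₁ ▸ hpos) (by rwa [e₁, e₂])
  rcases le_or_gt x l with hxl | hxl
  · exact Or.inl (hl x hxl)
  · have hxa : x < a := by
      by_contra! hle
      exact hx ⟨hle, hx01.2⟩
    right
    rw [← hM a ⟨le_rfl, ha1.le⟩]
    exact hmono ⟨hxl.le, hxa.le⟩ ⟨hla.le, le_rfl⟩ hxa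

lemma monotoneOn_of_strictMonoOn_of_const {m : ℝ → ℝ} {p q r : ℝ} (hpq : p ≤ q)
    (hmono : StrictMonoOn m (Icc p q)) (hconst : ∀ x ∈ Icc q r, m x = m q) :
    MonotoneOn m (Icc p r) := fun x hx y hy hxy => by
  rcases le_total y q with hyq | hyq
  · exact hmono.monotoneOn ⟨hx.1, hxy.trans hyq⟩ ⟨hy.1, hyq⟩ hxy
  · rw [hconst y ⟨hyq, hy.2⟩]
    rcases le_total x q with hxq | hxq
    · exact hmono.monotoneOn ⟨hx.1, hxq⟩ ⟨hpq, le_rfl⟩ hxq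
    · exact (hconst x ⟨hxq, hx.2⟩).le

lemma strictMonoOn_comp_neg {m : ℝ → ℝ} {a b : ℝ} (h : StrictAntiOn m (Icc a b)) :
    StrictMonoOn (fun x => m (-x)) (Icc (-b) (-a)) := fun x hx y hy hxy =>
  h ⟨by linarith [hy.2], by linarith [hy.1]⟩ ⟨by linarith [hx.2], by linarith [hx.1]⟩
    (neg_lt_neg hxy)

/-- Theorem 2.2: with `m` as in (T2),
`lim_{s→∞} λ₁ᴺ(s) = min{c(a₁), λ₁ᴰᴰ(a₂,a₃), λ₁ᴺᴰ(a₄,a₅), λ₁ᴺᴺ(a₆,1)}`. -/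
theorem lambdaN_tendsto_of_T2
    (m c : ℝ → ℝ) (hm : ContDiff ℝ 2 m) (hc : Continuous c)
    (a₁ a₂ a₃ a₄ a₅ a₆ : ℝ)
    (h0 : 0 < a₁) (h12 : a₁ < a₂) (h23 : a₂ < a₃) (h34 : a₃ < a₄) (h45 : a₄ < a₅)
    (h56 : a₅ < a₆) (h61 : a₆ < 1)
    (hi₁ : StrictMonoOn m (Set.Icc (0:ℝ) a₁))
    (hi₂ : StrictMonoOn m (Set.Icc a₃ a₄))
    (hi₃ : StrictMonoOn m (Set.Icc a₅ a₆))
    (hd₁ : StrictAntiOn m (Set.Icc a₁ a₂))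
    (hc₁ : ∀ x ∈ Set.Icc a₂ a₃, m x = m a₂)
    (hc₂ : ∀ x ∈ Set.Icc a₄ a₅, m x = m a₄)
    (hc₃ : ∀ x ∈ Set.Icc a₆ 1, m x = m a₆) :
    Tendsto (lambdaN m c) Filter.atTop
      (nhds (min (c a₁)
        (min (lambdaIJ c true true a₂ a₃)
          (min (lambdaIJ c false true a₄ a₅) (lambdaIJ c false false a₆ 1))))) := by
  have hm' : Continuous m := hm.continuous
  have hmn : Continuous fun x => m (-x) := hm'.comp continuous_neg
  have hcn : Continuous fun x => c (-x) := hc.comp continuous_neg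
  set Λ := min (c a₁) (min (lambdaIJ c true true a₂ a₃)
    (min (lambdaIJ c false true a₄ a₅) (lambdaIJ c false false a₆ 1))) with hΛ
  have hΛ₁ : Λ ≤ c a₁ := min_le_left _ _
  have hΛ₂ : Λ ≤ lambdaIJ c true true a₂ a₃ := (min_le_right _ _).trans (min_le_left _ _)
  have hΛ₃ : Λ ≤ lambdaIJ c false true a₄ a₅ :=
    (min_le_right _ _).trans ((min_le_right _ _).trans (min_le_left _ _))
  have hΛ₄ : Λ ≤ lambdaIJ c false false a₆ 1 :=
    (min_le_right _ _).trans ((min_le_right _ _).trans (min_le_right _ _))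
  have hlower : AsymptoticLowerBound m c Λ 0 1 0 1 := by
    have hneg := strictMonoOn_comp_neg hd₁
    have n₂ : NegligibleAt m 0 1 a₂ :=
      (negligibleAt_of_strictMonoOn hmn (neg_lt_neg h12) hneg).of_comp_neg.mono hm' h0.le h12.le
        (by linarith)
    have n₃ : NegligibleAt m 0 1 a₃ :=
      (negligibleAt_of_strictMonoOn hm' h34 hi₂).mono hm' (by linarith) h34.le (by linarith)
    have n₅ : NegligibleAt m 0 1 a₅ :=
      (negligibleAt_of_strictMonoOn hm' h56 hi₃).mono hm' (by linarith) h56.le h61.le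
    have b₀ : AsymptoticLowerBound m c Λ 0 1 0 a₁ :=
      (asymptoticLowerBound_of_strictMonoOn hm' hc h0 hi₁ hΛ₁).mono hm' le_rfl h0.le (by linarith)
    have b₁ : AsymptoticLowerBound m c Λ 0 1 a₁ a₂ :=
      (asymptoticLowerBound_of_strictMonoOn hmn hcn (neg_lt_neg h12) hneg
        (by rwa [neg_neg])).of_comp_neg.mono hm' h0.le h12.le (by linarith)
    have b₂ : AsymptoticLowerBound m c Λ 0 1 a₂ a₃ :=
      asymptoticLowerBound_of_const hm' hc (by linarith) h23 (by linarith) hc₁ (fun _ => n₂)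
        (fun _ => n₃) hΛ₂
    have b₃ : AsymptoticLowerBound m c Λ 0 1 a₃ a₄ :=
      (AsymptoticLowerBound.of_negligibleMass hm' hc (by linarith) h34.le
        (negligibleMass_of_strictMonoOn_of_monotoneOn hm' h34 h45 hi₂
          (monotoneOn_of_strictMonoOn_of_const h34.le hi₂ hc₂))).mono hm' (by linarith)
        (by linarith) (by linarith)
    have b₄ : AsymptoticLowerBound m c Λ 0 1 a₄ a₅ :=
      asymptoticLowerBound_of_const hm' hc (by linarith) h45 (by linarith) hc₂ (by simp)
        (fun _ => n₅) hΛ₃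
    have b₅ : AsymptoticLowerBound m c Λ 0 1 a₅ a₆ :=
      (AsymptoticLowerBound.of_negligibleMass hm' hc (by linarith) h56.le
        (negligibleMass_of_strictMonoOn_of_monotoneOn hm' h56 h61 hi₃
          (monotoneOn_of_strictMonoOn_of_const h56.le hi₃ hc₃))).mono hm' (by linarith)
        (by linarith) le_rfl
    have b₆ : AsymptoticLowerBound m c Λ 0 1 a₆ 1 :=
      asymptoticLowerBound_of_const hm' hc (by linarith) h61 le_rfl hc₃ (by simp) (by simp) hΛ₄
    exact (((((b₀.trans hm' hc b₁).trans hm' hc b₂).trans hm' hc b₃).trans hm' hc b₄).trans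
      hm' hc b₅).trans hm' hc b₆
  have hupper : ∀ R, Λ < R → ∀ᶠ s in atTop, lambdaN m c s ≤ R := fun R hR => by
    rw [hΛ, min_lt_iff, min_lt_iff, min_lt_iff] at hR
    rcases hR with h | h | h | h
    · exact eventually_lambdaN_le_of_strictMax hm' hc h0 h12 (by linarith) hi₁ hd₁ h
    · exact eventually_lambdaN_le_of_lambdaIJ_true_true hm' hc (by linarith) h23 (by linarith)
        hc₁ h
    · exact eventually_lambdaN_le_of_lambdaIJ_false_true hm' hc (by linarith) h34 h45
        (by linarith) hi₂ hc₂ h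
    · exact eventually_lambdaN_le_of_lambdaIJ_false_false hm' hc (by linarith) h56 h61 hi₃ hc₃ h
  refine tendsto_order.2 ⟨fun r hr => ?_, fun r hr => ?_⟩
  · filter_upwards [eventually_le_lambdaN hm' hc hlower (half_pos (sub_pos.2 hr))] with s hs
    linarith
  · filter_upwards [hupper ((Λ + r) / 2) (by linarith)] with s hs
    linarith
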